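/- For every radius r ∈ ℕ and every r-sphere isomorphism type S of nested words over a 2-stack call-return alphabet, and every threshold t ∈ ℕ, the languages {W ∈ NW(Σ̃) : |W|_S = t} and {W ∈ NW(Σ̃) : |W|_S > t} (where |W|_S is the number of positions of W whose r-sphere is isomorphic to S) are each recognizable by a generalized 2-stack nested-word automaton. -/

import Mathlib

/-- The *kind* of a letter in a `K`-stack call-return alphabet: a call of some
stack `s`, a return of some stack `s`, or an internal action. -/
inductive CRKind (K : ℕ) where
  | call (s : Fin K)
  | ret (s : Fin K)
  | int

/-- A `K`-stack call-return alphabet over the letters `A`: every letter is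
(exclusively) a call of one stack, a return of one stack, or internal.  This
encodes the pairwise disjointness of the collection
`⟨{(Σ_c^s, Σ_r^s)}_{s∈[K]}, Σ_int⟩` together with `Σ` being their union. -/
structure CRAlphabet (K : ℕ) (A : Type) where
  kind : A → CRKind K

namespace CRAlphabet

variable {K : ℕ} {A : Type}

def callSet (h : CRAlphabet K A) (s : Fin K) : Set A := {a | h.kind a = .call s}
def retSet (h : CRAlphabet K A) (s : Fin K) : Set A := {a | h.kind a = .ret s}
def intSet (h : CRAlphabet K A) : Set A := {a | h.kind a = .int}

end CRAlphabet

/-- `s`-well-formed strings: generated by the grammar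
`A ::= aAb | AA | ε | c` with `a ∈ c`, `b ∈ r`, `c ∉ c ∪ r`. -/
inductive SWellFormed {A : Type} (c r : Set A) : List A → Prop where
  | nil : SWellFormed c r []
  | single {x : A} : x ∉ c → x ∉ r → SWellFormed c r [x]
  | wrap {a b : A} {u : List A} : a ∈ c → b ∈ r → SWellFormed c r u →
      SWellFormed c r (a :: u ++ [b])
  | concat {u v : List A} : SWellFormed c r u → SWellFormed c r v →
      SWellFormed c r (u ++ v)

/-- The matching relation `μ^s` of the nested word determined by the string
`w` (positions `0`-based): `(i,j) ∈ μ^s` iff `i < j`, `λ(i) ∈ Σ_c^s`,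
`λ(j) ∈ Σ_r^s` and `λ(i+1) … λ(j-1)` is `s`-well formed. -/
def Matched {K : ℕ} {A : Type} (h : CRAlphabet K A) (w : List A) (s : Fin K)
    (i j : ℕ) : Prop :=
  i < j ∧ j < w.length ∧
  (∃ a, w[i]? = some a ∧ a ∈ h.callSet s) ∧
  (∃ b, w[j]? = some b ∧ b ∈ h.retSet s) ∧
  SWellFormed (h.callSet s) (h.retSet s) ((w.take j).drop (i + 1))

/-- The full matching relation `μ = ⋃_s μ^s`. -/
def MuAny {K : ℕ} {A : Type} (h : CRAlphabet K A) (w : List A) (i j : ℕ) : Prop :=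
  ∃ s, Matched h w s i j

/-- Gaifman adjacency of positions of the nested word of `w`:
`i ↔ j` iff `(i,j)` or `(j,i)` is in `⋖ ∪ μ`. -/
def Adj {K : ℕ} {A : Type} (h : CRAlphabet K A) (w : List A) (i j : ℕ) : Prop :=
  (j = i + 1 ∧ j < w.length) ∨ (i = j + 1 ∧ i < w.length) ∨
    MuAny h w i j ∨ MuAny h w j i

/-- `DistLE h w d i j`: the Gaifman distance between `i` and `j` in the
nested word of `w` is at most `d`. -/
def DistLE {K : ℕ} {A : Type} (h : CRAlphabet K A) (w : List A) :
    ℕ → ℕ → ℕ → Prop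
  | 0, i, j => i = j
  | d + 1, i, j => i = j ∨ ∃ k, Adj h w i k ∧ DistLE h w d k j

/-- The ball of radius `r` around position `i` (the universe of the
`r`-sphere `Sph_r(w,i)`). -/
def ball {K : ℕ} {A : Type} (h : CRAlphabet K A) (w : List A) (r i : ℕ) : Set ℕ :=
  {j | DistLE h w r i j}

/-- `f` is an isomorphism from the `r`-sphere of `v` around `c` onto the
`r`-sphere of `w` around `i` (mapping center to center and preserving labels,
successor edges and matching edges). -/
def SphIsoF {K : ℕ} {A : Type} (h : CRAlphabet K A) (r : ℕ) (v : List A) (c : ℕ)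
    (w : List A) (i : ℕ) (f : ℕ → ℕ) : Prop :=
  c < v.length ∧ i < w.length ∧ f c = i ∧
  Set.BijOn f (ball h v r c) (ball h w r i) ∧
  (∀ j ∈ ball h v r c, v[j]? = w[(f j)]?) ∧
  (∀ j ∈ ball h v r c, ∀ k ∈ ball h v r c,
    ((k = j + 1 ∧ k < v.length) ↔ (f k = f j + 1 ∧ f k < w.length)) ∧
    (∀ s, Matched h v s j k ↔ Matched h w s (f j) (f k)))

/-- The `r`-sphere of `v` around `c` is isomorphic to the `r`-sphere of `w`
around `i`. -/
def SphIso {K : ℕ} {A : Type} (h : CRAlphabet K A) (r : ℕ) (v : List A) (c : ℕ)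
    (w : List A) (i : ℕ) : Prop :=
  ∃ f, SphIsoF h r v c w i f

/-- A generalized multi-stack nested-word automaton (generalized MNWA) over a
`K`-stack call-return alphabet: `delta1` contains local/push/unmatched-return
transitions, `delta2` the transitions at matched returns (consulting also the
state reached at the matching call); `qC` is the set of calling states.  An
MNWA is a generalized MNWA with `qC = ∅`. -/
structure GMNWA (K : ℕ) (A : Type) (Q : Type) where
  delta1 : Q → A → Q → Prop
  delta2 : Q → Q → A → Q → Prop
  qI : Set Q
  qF : Set Q
  qC : Set Q

/-- `ρ` is a run of the generalized MNWA `B` on the (nonempty) nested word of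
`w` (positions `0`-based). -/
def gRun {K : ℕ} {A Q : Type} (h : CRAlphabet K A) (B : GMNWA K A Q)
    (w : List A) (ρ : ℕ → Q) : Prop :=
  (∃ q ∈ B.qI, ∃ a, w[0]? = some a ∧ B.delta1 q a (ρ 0)) ∧
  ∀ i, 0 < i → i < w.length → ∃ a, w[i]? = some a ∧
    ((∃ j, MuAny h w j i ∧ B.delta2 (ρ j) (ρ (i - 1)) a (ρ i)) ∨
     ((¬ ∃ j, MuAny h w j i) ∧ B.delta1 (ρ (i - 1)) a (ρ i)))

/-- The run `ρ` of `B` on `w` is accepting: it ends in a final state, and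
every position carrying a calling state is a call with a matching return. -/
def gAcc {K : ℕ} {A Q : Type} (h : CRAlphabet K A) (B : GMNWA K A Q)
    (w : List A) (ρ : ℕ → Q) : Prop :=
  ρ (w.length - 1) ∈ B.qF ∧ ∀ i < w.length, ρ i ∈ B.qC → ∃ j, MuAny h w i j

/-- The language of the generalized MNWA `B` (as a set of nonempty strings,
identified with their nested words via the canonical bijection). -/
def gLang {K : ℕ} {A Q : Type} (h : CRAlphabet K A) (B : GMNWA K A Q) :
    Set (List A) :=
  {w | w ≠ [] ∧ ∃ ρ, gRun h B w ρ ∧ gAcc h B w ρ}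

namespace NestedWord

open Classical in
/-- The number of letters of `u` in `c` minus the number of letters in `r`. -/
noncomputable def balance {A : Type} (c r : Set A) (u : List A) : ℤ :=
  (u.map fun a => if a ∈ c then (1 : ℤ) else if a ∈ r then -1 else 0).sum

lemma balance_append {A : Type} (c r : Set A) (u v : List A) :
    balance c r (u ++ v) = balance c r u + balance c r v := by
  simp [balance]

lemma balance_call {A : Type} {c r : Set A} {a : A} (ha : a ∈ c) : balance c r [a] = 1 := by
  simp [balance, ha]

lemma balance_ret {A : Type} {c r : Set A} (hd : Disjoint c r) {a : A} (ha : a ∈ r) :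
    balance c r [a] = -1 := by
  have : a ∉ c := fun h => Set.disjoint_left.1 hd h ha
  simp [balance, ha, this]

/-- A well-formed string is balanced, and all its prefixes have nonnegative balance. -/
lemma balance_of_wellFormed {A : Type} {c r : Set A} (hd : Disjoint c r) {u : List A}
    (hu : SWellFormed c r u) : balance c r u = 0 ∧ ∀ k, 0 ≤ balance c r (u.take k) := by
  induction hu with
  | nil => simp [balance]
  | single h1 h2 =>
    refine ⟨by simp [balance, h1, h2], fun k => ?_⟩
    rcases k with _ | k <;> simp [balance, h1, h2]
  | @wrap a b u ha hb _ ih =>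
    have e : ∀ l : List A, a :: l = [a] ++ l := fun _ => rfl
    constructor
    · rw [List.cons_append, e, balance_append, balance_append, balance_call ha, balance_ret hd hb,
        ih.1]
      norm_num
    · rintro (_ | k)
      · simp [balance]
      · rw [List.cons_append, List.take_succ_cons, e, balance_append, balance_call ha,
          List.take_append, balance_append]
        have h1 := ih.2 k
        have h2 : -1 ≤ balance c r ([b].take (k - u.length)) := by
          rcases k - u.length with _ | m
          · simp [balance]
          · simp [balance_ret hd hb]
        linarith
  | @concat u v _ _ ihu ihv =>
    refine ⟨by rw [balance_append, ihu.1, ihv.1, add_zero], fun k => ?_⟩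
    rw [List.take_append, balance_append]
    exact add_nonneg (ihu.2 k) (ihv.2 _)

variable {K : ℕ} {A : Type} (h : CRAlphabet K A) (w : List A)

lemma disjoint_callSet_retSet (s : Fin K) : Disjoint (h.callSet s) (h.retSet s) := by
  rw [Set.disjoint_left]
  intro a h1 h2
  simp only [CRAlphabet.callSet, CRAlphabet.retSet, Set.mem_ofPred_eq] at h1 h2
  simp [h1] at h2

/-- The height of stack `s` before position `k`. -/
noncomputable def height (s : Fin K) (k : ℕ) : ℤ :=
  balance (h.callSet s) (h.retSet s) (w.take k)

variable {h w}

lemma height_succ_call {s : Fin K} {i : ℕ} {a : A} (hi : w[i]? = some a) (ha : a ∈ h.callSet s) :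
    height h w s (i + 1) = height h w s i + 1 := by
  rw [height, List.take_add_one, hi, balance_append, Option.toList_some, balance_call ha, height]

lemma height_succ_ret {s : Fin K} {i : ℕ} {a : A} (hi : w[i]? = some a) (ha : a ∈ h.retSet s) :
    height h w s (i + 1) = height h w s i - 1 := by
  rw [height, List.take_add_one, hi, balance_append, Option.toList_some,
    balance_ret (disjoint_callSet_retSet h s) ha, height, sub_eq_add_neg]

/-- The height profile between a call and the matching return. -/
lemma matched_height {s : Fin K} {i j : ℕ} (hm : Matched h w s i j) :
    i < j ∧ height h w s (i + 1) = height h w s i + 1 ∧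
      height h w s (j + 1) = height h w s j - 1 ∧ height h w s j = height h w s (i + 1) ∧
      ∀ k, i + 1 ≤ k → k ≤ j → height h w s (i + 1) ≤ height h w s k := by
  obtain ⟨hij, -, ⟨a, hia, ha⟩, ⟨b, hjb, hb⟩, hwf⟩ := hm
  have hbal := balance_of_wellFormed (disjoint_callSet_retSet h s) hwf
  have key : ∀ k, i + 1 ≤ k → k ≤ j → height h w s k = height h w s (i + 1) +
      balance (h.callSet s) (h.retSet s) (((w.take j).drop (i + 1)).take (k - (i + 1))) := by
    intro k h1 h2
    rw [height, height, ← balance_append]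
    congr 1
    obtain ⟨m, rfl⟩ := Nat.exists_eq_add_of_le h1
    rw [List.take_add, List.drop_take, List.take_take]
    congr 2
    omega
  refine ⟨hij, height_succ_call hia ha, height_succ_ret hjb hb, ?_, fun k h1 h2 => ?_⟩
  · rw [key j hij le_rfl, List.take_of_length_le, hbal.1, add_zero]
    simp only [List.length_drop, List.length_take]
    omega
  · rw [key k h1 h2]
    linarith [hbal.2 (k - (i + 1))]

lemma matched_call_kind {s : Fin K} {i j : ℕ} (hm : Matched h w s i j) :
    ∃ a, w[i]? = some a ∧ h.kind a = .call s := hm.2.2.1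

lemma matched_ret_kind {s : Fin K} {i j : ℕ} (hm : Matched h w s i j) :
    ∃ a, w[j]? = some a ∧ h.kind a = .ret s := hm.2.2.2.1

lemma matched_right_unique {s : Fin K} {i j j' : ℕ} (h1 : Matched h w s i j)
    (h2 : Matched h w s i j') : j = j' := by
  obtain ⟨a1, a2, a3, a4, a5⟩ := matched_height h1
  obtain ⟨b1, b2, b3, b4, b5⟩ := matched_height h2
  rcases lt_trichotomy j j' with hlt | heq | hlt
  · have := b5 (j + 1) (by omega) (by omega)
    omega
  · exact heq
  · have := a5 (j' + 1) (by omega) (by omega)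
    omega

lemma matched_left_unique {s : Fin K} {i i' j : ℕ} (h1 : Matched h w s i j)
    (h2 : Matched h w s i' j) : i = i' := by
  obtain ⟨a1, a2, a3, a4, a5⟩ := matched_height h1
  obtain ⟨b1, b2, b3, b4, b5⟩ := matched_height h2
  rcases lt_trichotomy i i' with hlt | heq | hlt
  · have := a5 i' (by omega) (by omega)
    omega
  · exact heq
  · have := b5 i (by omega) (by omega)
    omega

/-- Two matching edges of the same stack do not cross: an edge whose call lies strictly inside
another edge is nested in it. -/
lemma matched_nested_of_call {s : Fin K} {i j k l : ℕ} (h1 : Matched h w s i j)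
    (h2 : Matched h w s k l) (hik : i < k) (hkj : k < j) : l < j := by
  obtain ⟨a1, a2, a3, a4, a5⟩ := matched_height h1
  obtain ⟨b1, b2, b3, b4, b5⟩ := matched_height h2
  by_contra! hlj
  have c1 := a5 k (by omega) (by omega)
  have c2 := b5 j (by omega) (by omega)
  omega

lemma matched_nested_of_ret {s : Fin K} {i j k l : ℕ} (h1 : Matched h w s i j)
    (h2 : Matched h w s k l) (hil : i < l) (hlj : l < j) : i < k := by
  obtain ⟨a1, a2, a3, a4, a5⟩ := matched_height h1
  obtain ⟨b1, b2, b3, b4, b5⟩ := matched_height h2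
  by_contra! hki
  have c1 := a5 (l + 1) (by omega) (by omega)
  have c2 := b5 (i + 1) (by omega) (by omega)
  omega

end NestedWord

namespace NestedWord

/-- The three directions in which a position of a nested word may have a neighbour. -/
inductive Dir where
  | prev
  | next
  | mat

namespace Dir

/-- The direction leading back. -/
def inv : Dir → Dir
  | prev => next
  | next => prev
  | mat => mat

@[simp] lemma inv_inv (d : Dir) : d.inv.inv = d := by cases d <;> rfl

instance : Finite Dir :=
  Finite.of_surjective (fun i : Fin 3 => match i with | 0 => prev | 1 => next | 2 => mat)
    (fun d => by cases d; exacts [⟨0, rfl⟩, ⟨1, rfl⟩, ⟨2, rfl⟩])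

end Dir

variable {K : ℕ} {A : Type} (h : CRAlphabet K A) (w : List A)

/-- `j` is the neighbour of `i` in the given direction. -/
def Edge : Dir → ℕ → ℕ → Prop
  | .prev, i, j => i = j + 1 ∧ i < w.length
  | .next, i, j => j = i + 1 ∧ j < w.length
  | .mat, i, j => MuAny h w i j ∨ MuAny h w j i

open Classical in
/-- The neighbour of a position in a given direction, if there is one. -/
noncomputable def step (d : Dir) (i : ℕ) : Option ℕ :=
  if hj : ∃ j, Edge h w d i j then some hj.choose else none

/-- The endpoint of the walk from `i` following the given directions, if it exists. -/
noncomputable def walk : List Dir → ℕ → Option ℕ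
  | [], i => some i
  | d :: u, i => (step h w d i).bind (walk u)

/-- The reversal of a word of directions. -/
def revWord (u : List Dir) : List Dir := (u.map Dir.inv).reverse

@[simp] lemma length_revWord (u : List Dir) : (revWord u).length = u.length := by simp [revWord]

@[simp] lemma revWord_revWord (u : List Dir) : revWord (revWord u) = u := by
  simp [revWord, List.map_reverse, Function.comp_def]

variable {h w}

lemma muAny_right_unique {i j j' : ℕ} (h1 : MuAny h w i j) (h2 : MuAny h w i j') : j = j' := by
  obtain ⟨s, h1⟩ := h1
  obtain ⟨s', h2⟩ := h2
  obtain ⟨a, ha, hk⟩ := matched_call_kind h1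
  obtain ⟨a', ha', hk'⟩ := matched_call_kind h2
  obtain rfl : a = a' := by simpa [ha] using ha'
  obtain rfl : s = s' := by simpa [hk] using hk'
  exact matched_right_unique h1 h2

lemma muAny_left_unique {i i' j : ℕ} (h1 : MuAny h w i j) (h2 : MuAny h w i' j) : i = i' := by
  obtain ⟨s, h1⟩ := h1
  obtain ⟨s', h2⟩ := h2
  obtain ⟨a, ha, hk⟩ := matched_ret_kind h1
  obtain ⟨a', ha', hk'⟩ := matched_ret_kind h2
  obtain rfl : a = a' := by simpa [ha] using ha'
  obtain rfl : s = s' := by simpa [hk] using hk'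
  exact matched_left_unique h1 h2

lemma not_muAny_of_muAny {i j k : ℕ} (h1 : MuAny h w i j) : ¬ MuAny h w k i := by
  rintro ⟨s', h2⟩
  obtain ⟨s, h1⟩ := h1
  obtain ⟨a, ha, hk⟩ := matched_call_kind h1
  obtain ⟨a', ha', hk'⟩ := matched_ret_kind h2
  obtain rfl : a = a' := by simpa [ha] using ha'
  simp [hk] at hk'

lemma muAny_lt {i j : ℕ} (h1 : MuAny h w i j) : i < j ∧ j < w.length := by
  obtain ⟨s, h1⟩ := h1
  exact ⟨h1.1, h1.2.1⟩

lemma Edge.symm {d : Dir} {i j : ℕ} (he : Edge h w d i j) : Edge h w d.inv j i := by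
  cases d
  · exact he
  · exact he
  · exact Or.symm he

lemma Edge.unique {d : Dir} {i j j' : ℕ} (h1 : Edge h w d i j) (h2 : Edge h w d i j') :
    j = j' := by
  cases d
  · have := h1.1.symm.trans h2.1
    omega
  · exact h1.1.trans h2.1.symm
  · rcases h1 with h1 | h1 <;> rcases h2 with h2 | h2
    · exact muAny_right_unique h1 h2
    · exact (not_muAny_of_muAny h1 h2).elim
    · exact (not_muAny_of_muAny h2 h1).elim
    · exact muAny_left_unique h1 h2

lemma Edge.lt_left {d : Dir} {i j : ℕ} (he : Edge h w d i j) : i < w.length := by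
  cases d
  · exact he.2
  · have := he.1
    have := he.2
    omega
  · rcases he with he | he
    · have := muAny_lt he
      omega
    · exact (muAny_lt he).2

lemma Edge.lt_right {d : Dir} {i j : ℕ} (he : Edge h w d i j) : j < w.length :=
  he.symm.lt_left

lemma Edge.ne {d : Dir} {i j : ℕ} (he : Edge h w d i j) : i ≠ j := by
  cases d
  · have := he.1
    omega
  · have := he.1
    omega
  · rcases he with he | he <;> have := muAny_lt he <;> omega

lemma adj_iff_exists_edge {i j : ℕ} : Adj h w i j ↔ ∃ d, Edge h w d i j := by
  constructor
  · rintro (he | he | he | he)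
    exacts [⟨.next, he⟩, ⟨.prev, he⟩, ⟨.mat, Or.inl he⟩, ⟨.mat, Or.inr he⟩]
  · rintro ⟨d, he⟩
    cases d
    · exact Or.inr (Or.inl he)
    · exact Or.inl he
    · exact Or.inr (Or.inr he)

lemma step_eq_some {d : Dir} {i j : ℕ} : step h w d i = some j ↔ Edge h w d i j := by
  rw [step]
  split_ifs with hj
  · rw [Option.some_inj]
    exact ⟨fun e => e ▸ hj.choose_spec, fun he => hj.choose_spec.unique he⟩
  · simpa using fun he => hj ⟨j, he⟩

lemma step_eq_none {d : Dir} {i : ℕ} : step h w d i = none ↔ ∀ j, ¬ Edge h w d i j := by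
  rw [Option.eq_none_iff_forall_ne_some]
  simp [step_eq_some]

@[simp] lemma walk_nil (i : ℕ) : walk h w [] i = some i := rfl

lemma walk_cons (d : Dir) (u : List Dir) (i : ℕ) :
    walk h w (d :: u) i = (step h w d i).bind (walk h w u) := rfl

@[simp] lemma walk_singleton (d : Dir) (i : ℕ) : walk h w [d] i = step h w d i := by
  rw [walk_cons]
  cases step h w d i <;> rfl

lemma walk_append (u v : List Dir) (i : ℕ) :
    walk h w (u ++ v) i = (walk h w u i).bind (walk h w v) := by
  induction u generalizing i with
  | nil => rfl
  | cons d u ih =>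
    rw [List.cons_append, walk_cons, walk_cons, Option.bind_assoc]
    exact congrArg _ (funext ih)

lemma walk_append_of_eq {u : List Dir} {i j : ℕ} (v : List Dir) (hu : walk h w u i = some j) :
    walk h w (u ++ v) i = walk h w v j := by
  rw [walk_append, hu, Option.bind_some]

lemma walk_revWord_of_eq {u : List Dir} {i j : ℕ} (hu : walk h w u i = some j) :
    walk h w (revWord u) j = some i := by
  induction u generalizing i with
  | nil =>
    obtain rfl : i = j := by simpa using hu
    rfl
  | cons d u ih =>
    rw [walk_cons, Option.bind_eq_some_iff] at hu
    obtain ⟨k, hk, hu⟩ := hu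
    have e : revWord (d :: u) = revWord u ++ [d.inv] := by simp [revWord]
    rw [e, walk_append_of_eq _ (ih hu), walk_singleton, step_eq_some]
    exact (step_eq_some.1 hk).symm

lemma walk_revWord {u : List Dir} {i j : ℕ} :
    walk h w (revWord u) j = some i ↔ walk h w u i = some j :=
  ⟨fun hu => by simpa using walk_revWord_of_eq hu, walk_revWord_of_eq⟩

lemma walk_inj {u : List Dir} {i i' j : ℕ} (h1 : walk h w u i = some j)
    (h2 : walk h w u i' = some j) : i = i' := by
  have := (walk_revWord_of_eq h1).symm.trans (walk_revWord_of_eq h2)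
  simpa using this

lemma walk_lt {u : List Dir} {i j : ℕ} (hi : i < w.length) (hu : walk h w u i = some j) :
    j < w.length := by
  induction u generalizing i with
  | nil =>
    obtain rfl : i = j := by simpa using hu
    exact hi
  | cons d u ih =>
    rw [walk_cons, Option.bind_eq_some_iff] at hu
    obtain ⟨k, hk, hu⟩ := hu
    exact ih (step_eq_some.1 hk).lt_right hu

end NestedWord

namespace NestedWord

/-- The indicator of `x < y`, as an integer. -/
def ltInd (x y : ℤ) : ℤ := if x < y then 1 else 0

@[simp] lemma ltInd_self (x : ℤ) : ltInd x x = 0 := by simp [ltInd]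

/-- **Umlaufsatz** for closed rectilinear curves.  The curve runs vertically along `x = p a` from
height `e (a - 1)` to height `e a`, and then horizontally at height `e a` from `p a` to `p (a + 1)`.
If no vertical side meets a non-adjacent horizontal side, then the curve has
turning number `±1`. -/
theorem turning_number {N : ℕ} {p e : ℕ → ℤ} (hp : p N = p 0) (hp' : p (N + 1) = p 1)
    (he : e N = e 0) (hinj : ∀ a b, a < N → b < N → p a = p b → a = b)
    (hmin : ∀ a, 0 < a → a < N → p 0 < p a) (hne : e 0 ≠ e (N - 1))
    (hcross : ∀ a b, a + 1 < N → b < N → b ≠ a → b ≠ a + 1 →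
      (p b < p (a + 1) ∧ p (a + 1) < p (b + 1) ∨ p (b + 1) < p (a + 1) ∧ p (a + 1) < p b) →
      e b < e a ∧ e b < e (a + 1) ∨ e a < e b ∧ e (a + 1) < e b) :
    ∑ a ∈ Finset.range N, ltInd (e a) (e (a + 1)) *
      (ltInd (p a) (p (a + 1)) - ltInd (p (a + 1)) (p (a + 2))) = 1 ∨
    ∑ a ∈ Finset.range N, ltInd (e a) (e (a + 1)) *
      (ltInd (p a) (p (a + 1)) - ltInd (p (a + 1)) (p (a + 2))) = -1 := by
  obtain ⟨n, rfl⟩ : ∃ n, N = n + 2 := by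
    rcases N with _ | _ | n
    · simp at hne
    · simp at hne
    · exact ⟨n, rfl⟩
  have key : ∀ m, m ≤ n + 1 →
      ∑ a ∈ Finset.range m, ltInd (e a) (e (a + 1)) *
        (ltInd (p a) (p (a + 1)) - ltInd (p (a + 1)) (p (a + 2))) =
      ∑ b ∈ Finset.range m, ltInd (p 0) (p (b + 1)) *
        (ltInd (e 0) (e (b + 1)) - ltInd (e 0) (e b)) +
      ∑ a ∈ Finset.range m, ltInd (p (a + 1)) (p (m + 1)) *
        (ltInd (e (a + 1)) (e m) - ltInd (e a) (e m)) := by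
    intro m hm
    induction m with
    | zero => simp
    | succ m ih =>
      have hcross₁ : ∀ a ∈ Finset.range m, ltInd (p (a + 1)) (p (m + 1)) *
            (ltInd (e a) (e (m + 1)) - ltInd (e a) (e m)) =
          ltInd (p a) (p (m + 1)) * (ltInd (e a) (e (m + 1)) - ltInd (e a) (e m)) := by
        intro a ha
        rw [Finset.mem_range] at ha
        have h1 := hcross m a (by omega) (by omega) (by omega) (by omega)
        have h2 := hinj (m + 1) a (by omega) (by omega)
        have h3 := hinj (m + 1) (a + 1) (by omega) (by omega)
        simp only [ltInd]
        split_ifs <;> first | rfl | (exfalso; omega)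
      have hcross₂ : ∀ a ∈ Finset.range m, ltInd (p (a + 1)) (p (m + 1 + 1)) *
            (ltInd (e (a + 1)) (e (m + 1)) - ltInd (e a) (e (m + 1))) =
          ltInd (p (a + 1)) (p (m + 1)) *
            (ltInd (e (a + 1)) (e (m + 1)) - ltInd (e a) (e (m + 1))) := by
        intro a ha
        rw [Finset.mem_range] at ha
        have h1 := hcross a (m + 1) (by omega) (by omega) (by omega) (by omega)
        have h2 := hinj (a + 1) (m + 1) (by omega) (by omega)
        have h3 : p (a + 1) ≠ p (m + 1 + 1) := by
          rcases Nat.lt_or_ge (m + 1 + 1) (n + 2) with hlt | hge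
          · intro hpe
            have := hinj (a + 1) (m + 1 + 1) (by omega) hlt hpe
            omega
          · obtain rfl : m = n := by omega
            rw [hp]
            exact (hmin _ (by omega) (by omega)).ne'
        simp only [ltInd]
        split_ifs <;> first | rfl | (exfalso; omega)
      have htel := Finset.sum_range_sub (fun a => ltInd (p a) (p (m + 1)) *
        (ltInd (e a) (e (m + 1)) - ltInd (e a) (e m))) m
      rw [Finset.sum_range_succ, Finset.sum_range_succ, ih (by omega), Finset.sum_range_succ,
        Finset.sum_congr rfl hcross₂]
      have hsum : ∑ a ∈ Finset.range m, ltInd (p (a + 1)) (p (m + 1)) *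
            (ltInd (e (a + 1)) (e (m + 1)) - ltInd (e a) (e (m + 1))) =
          ∑ a ∈ Finset.range m, ltInd (p (a + 1)) (p (m + 1)) *
            (ltInd (e (a + 1)) (e m) - ltInd (e a) (e m)) +
          ∑ a ∈ Finset.range m, (ltInd (p (a + 1)) (p (m + 1)) *
            (ltInd (e (a + 1)) (e (m + 1)) - ltInd (e (a + 1)) (e m)) -
            ltInd (p a) (p (m + 1)) * (ltInd (e a) (e (m + 1)) - ltInd (e a) (e m))) := by
        rw [← Finset.sum_add_distrib]
        refine Finset.sum_congr rfl fun a ha => ?_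
        linear_combination -hcross₁ a ha
      rw [hsum, htel]
      simp only [ltInd_self]
      ring
  have hC : ∑ b ∈ Finset.range (n + 1), ltInd (p 0) (p (b + 1)) *
      (ltInd (e 0) (e (b + 1)) - ltInd (e 0) (e b)) = ltInd (e 0) (e (n + 1)) := by
    rw [Finset.sum_congr rfl (g := fun b => ltInd (e 0) (e (b + 1)) - ltInd (e 0) (e b)),
      Finset.sum_range_sub (fun b => ltInd (e 0) (e b)), ltInd_self, sub_zero]
    intro b hb
    rw [Finset.mem_range] at hb
    rw [ltInd, if_pos (hmin (b + 1) (by omega) (by omega)), one_mul]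
  have hR : ∑ a ∈ Finset.range (n + 1), ltInd (p (a + 1)) (p (n + 1 + 1)) *
      (ltInd (e (a + 1)) (e (n + 1)) - ltInd (e a) (e (n + 1))) = 0 := by
    refine Finset.sum_eq_zero fun a ha => ?_
    rw [Finset.mem_range] at ha
    rw [hp, ltInd, if_neg (hmin (a + 1) (by omega) (by omega)).not_gt, zero_mul]
  rw [Finset.sum_range_succ, key (n + 1) le_rfl, hC, hR]
  have h1 := hmin 1 (by omega) (by omega)
  have h2 := hmin (n + 1) (by omega) (by omega)
  have h3 : e 0 ≠ e (n + 1) := hne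
  rw [show n + 1 + 2 = n + 2 + 1 from rfl, show n + 1 + 1 = n + 2 from rfl, hp, hp', he]
  simp only [ltInd]
  split_ifs <;> omega

end NestedWord

namespace NestedWord

lemma sum_range_add_of_periodic {N : ℕ} {G : ℕ → ℤ} (hG : ∀ a, G (a + N) = G a) (k : ℕ) :
    ∑ a ∈ Finset.range N, G (a + k) = ∑ a ∈ Finset.range N, G a := by
  induction k with
  | zero => rfl
  | succ k ih =>
    have h1 := Finset.sum_range_succ' (fun a => G (a + k)) N
    rw [Finset.sum_range_succ, add_comm N k, hG] at h1
    simp only [zero_add, add_right_cancel_iff] at h1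
    rw [← ih, h1]
    exact Finset.sum_congr rfl fun a _ => by rw [add_right_comm, add_assoc]

lemma sum_range_mul_of_periodic {n : ℕ} {G : ℕ → ℤ} (hG : ∀ a, G (a + n) = G a) (m : ℕ) :
    ∑ a ∈ Finset.range (m * n), G a = m * ∑ a ∈ Finset.range n, G a := by
  induction m with
  | zero => simp
  | succ m ih =>
    rw [Nat.succ_mul, Finset.sum_range_add, ih]
    have := sum_range_add_of_periodic hG (m * n)
    simp only [add_comm _ (m * n)] at this
    rw [this]
    push_cast
    ring

/-- The sign of the half-plane in which the matching edges of a stack are drawn. -/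
def stackSign (s : Fin 2) : ℤ := if s = 0 then 1 else -1

/-- The sign of the height at which the edge leaving a position in a given direction is drawn. -/
def edgeSign (d : Dir) (k : CRKind 2) : ℤ :=
  match d, k with
  | .mat, .call s => stackSign s
  | .mat, .ret s => stackSign s
  | _, _ => 0

/-- Whether the edge leaving a position in a given direction leads to the right. -/
def rightInd (d : Dir) (k : CRKind 2) : ℤ :=
  match d, k with
  | .next, _ => 1
  | .mat, .call _ => 1
  | _, _ => 0

lemma matched_nested {K : ℕ} {A : Type} {h : CRAlphabet K A} {w : List A} {s : Fin K}
    {lo hi lo' hi' : ℕ} (h1 : Matched h w s lo hi) (h2 : Matched h w s lo' hi')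
    (hb : lo < lo' ∧ lo' < hi ∨ lo < hi' ∧ hi' < hi) : lo < lo' ∧ hi' < hi := by
  rcases hb with hb | hb
  · exact ⟨hb.1, matched_nested_of_call h1 h2 hb.1 hb.2⟩
  · exact ⟨matched_nested_of_ret h1 h2 hb.1 hb.2, hb.2⟩

/-- An infinite walk in a nested word, recording the kinds of the visited letters. -/
structure IsPath {A : Type} (h : CRAlphabet 2 A) (w : List A) (x : ℕ → ℕ) (dir : ℕ → Dir)
    (kd : ℕ → CRKind 2) : Prop where
  edge : ∀ a, Edge h w (dir a) (x a) (x (a + 1))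
  kind : ∀ a, ∃ b, w[x a]? = some b ∧ h.kind b = kd a

/-- The height at which the `a`-th edge of a path is drawn. -/
def pathHeight (x : ℕ → ℕ) (dir : ℕ → Dir) (kd : ℕ → CRKind 2) (a : ℕ) : ℤ :=
  edgeSign (dir a) (kd a) * |(x (a + 1) : ℤ) - x a|

variable {A : Type} {h : CRAlphabet 2 A} {w : List A} {x : ℕ → ℕ} {dir : ℕ → Dir}
  {kd : ℕ → CRKind 2}

namespace IsPath

lemma pathHeight_of_ne (hx : IsPath h w x dir kd) {a : ℕ} (ha : dir a ≠ .mat) :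
    pathHeight x dir kd a = 0 ∧ (x (a + 1) = x a + 1 ∨ x a = x (a + 1) + 1) := by
  have he := hx.edge a
  rw [pathHeight]
  rcases hd : dir a with _ | _ | _
  · rw [hd] at he
    exact ⟨by simp [edgeSign], Or.inr he.1⟩
  · rw [hd] at he
    exact ⟨by simp [edgeSign], Or.inl he.1⟩
  · exact (ha hd).elim

lemma pathHeight_of_mat (hx : IsPath h w x dir kd) {a : ℕ} (ha : dir a = .mat) :
    ∃ s lo hi, Matched h w s lo hi ∧ pathHeight x dir kd a = stackSign s * ((hi : ℤ) - lo) ∧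
      (x a = lo ∧ x (a + 1) = hi ∧ kd a = .call s ∨ x a = hi ∧ x (a + 1) = lo ∧ kd a = .ret s) := by
  have he := hx.edge a
  obtain ⟨b, hb, hk⟩ := hx.kind a
  rw [pathHeight]
  rw [ha] at he ⊢
  rcases he with ⟨s, hm⟩ | ⟨s, hm⟩
  · obtain ⟨b', hb', hk'⟩ := matched_call_kind hm
    obtain rfl : b = b' := by simpa [hb] using hb'
    have hka : kd a = .call s := hk.symm.trans hk'
    refine ⟨s, x a, x (a + 1), hm, ?_, Or.inl ⟨rfl, rfl, hka⟩⟩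
    have := hm.1
    rw [hka, abs_of_pos (by omega)]
    rfl
  · obtain ⟨b', hb', hk'⟩ := matched_ret_kind hm
    obtain rfl : b = b' := by simpa [hb] using hb'
    have hka : kd a = .ret s := hk.symm.trans hk'
    refine ⟨s, x (a + 1), x a, hm, ?_, Or.inr ⟨rfl, rfl, hka⟩⟩
    have := hm.1
    rw [hka, abs_of_neg (by omega), neg_sub]
    rfl

lemma ltInd_eq (hx : IsPath h w x dir kd) (a : ℕ) :
    ltInd (x a) (x (a + 1)) = rightInd (dir a) (kd a) := by
  rcases hd : dir a with _ | _ | _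
  · have he := hx.edge a
    rw [hd] at he
    have := he.1
    rw [ltInd, if_neg (by omega)]
    cases kd a <;> rfl
  · have he := hx.edge a
    rw [hd] at he
    have := he.1
    rw [ltInd, if_pos (by omega), rightInd]
  · obtain ⟨s, lo, hi, hm, -, ⟨h1, h2, h3⟩ | ⟨h1, h2, h3⟩⟩ := hx.pathHeight_of_mat hd
    · have := hm.1
      rw [h3, ltInd, if_pos (by omega), rightInd]
    · have := hm.1
      rw [h3, ltInd, if_neg (by omega)]
      rfl

lemma edgeSign_of_ne {d : Dir} (hd : d ≠ .mat) (k : CRKind 2) : edgeSign d k = 0 := by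
  cases d <;> simp_all [edgeSign]

lemma back_of_mat (hx : IsPath h w x dir kd) {a : ℕ} (h1 : dir a = .mat)
    (h2 : dir (a + 1) = .mat) : x (a + 2) = x a := by
  have e1 := hx.edge a
  have e2 := hx.edge (a + 1)
  rw [h1] at e1
  rw [h2] at e2
  exact e2.unique e1.symm

lemma abs_pos (hx : IsPath h w x dir kd) (a : ℕ) : 0 < |(x (a + 1) : ℤ) - x a| := by
  have := (hx.edge a).ne
  rw [_root_.abs_pos]
  omega

lemma ltInd_pathHeight (hx : IsPath h w x dir kd) {a : ℕ} (hback : x (a + 2) ≠ x a) :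
    ltInd (pathHeight x dir kd a) (pathHeight x dir kd (a + 1)) =
      ltInd (edgeSign (dir a) (kd a)) (edgeSign (dir (a + 1)) (kd (a + 1))) := by
  have p1 := hx.abs_pos a
  have p2 := hx.abs_pos (a + 1)
  simp only [ltInd]
  congr 1
  rw [pathHeight, pathHeight, eq_iff_iff]
  by_cases h1 : dir a = .mat
  · have h2 : dir (a + 1) ≠ .mat := fun h2 => hback (hx.back_of_mat h1 h2)
    rw [edgeSign_of_ne h2, zero_mul]
    exact ⟨fun hlt => by nlinarith, fun hlt => by nlinarith⟩
  · rw [edgeSign_of_ne h1, zero_mul]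
    exact ⟨fun hlt => by nlinarith, fun hlt => by nlinarith⟩

/-- An edge with an endpoint strictly inside a matching edge is drawn below it. -/
lemma pathHeight_lt (hx : IsPath h w x dir kd) {s : Fin 2} {lo hi c : ℕ}
    (hm : Matched h w s lo hi)
    (hc : lo < x c ∧ x c < hi ∨ lo < x (c + 1) ∧ x (c + 1) < hi) :
    (s = 0 → pathHeight x dir kd c < (hi : ℤ) - lo) ∧
      (s = 1 → -((hi : ℤ) - lo) < pathHeight x dir kd c) := by
  have hlt := hm.1
  by_cases hd : dir c = .mat
  · obtain ⟨s', lo', hi', hm', he, hends⟩ := hx.pathHeight_of_mat hd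
    have hlt' := hm'.1
    rw [he]
    by_cases hs : s' = s
    · subst hs
      have := matched_nested hm hm' (by omega)
      constructor <;> rintro rfl <;> simp [stackSign] <;> omega
    · constructor
      · rintro rfl
        obtain rfl : s' = 1 := by omega
        simp [stackSign]
        omega
      · rintro rfl
        obtain rfl : s' = 0 := by omega
        simp [stackSign]
        omega
  · rw [(hx.pathHeight_of_ne hd).1]
    omega

lemma noncrossing (hx : IsPath h w x dir kd) {a b : ℕ}
    (hb : x b < x (a + 1) ∧ x (a + 1) < x (b + 1) ∨ x (b + 1) < x (a + 1) ∧ x (a + 1) < x b) :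
    pathHeight x dir kd b < pathHeight x dir kd a ∧
        pathHeight x dir kd b < pathHeight x dir kd (a + 1) ∨
      pathHeight x dir kd a < pathHeight x dir kd b ∧
        pathHeight x dir kd (a + 1) < pathHeight x dir kd b := by
  by_cases hd : dir b = .mat
  · obtain ⟨s, lo, hi, hm, he, hends⟩ := hx.pathHeight_of_mat hd
    have hends' : x b = lo ∧ x (b + 1) = hi ∨ x b = hi ∧ x (b + 1) = lo :=
      hends.imp (fun hh => ⟨hh.1, hh.2.1⟩) (fun hh => ⟨hh.1, hh.2.1⟩)
    have hlt := hm.1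
    have h1 := hx.pathHeight_lt (c := a) hm (by omega)
    have h2 := hx.pathHeight_lt (c := a + 1) hm (by omega)
    rw [he]
    obtain rfl | rfl : s = 0 ∨ s = 1 := by omega
    · simp only [stackSign, if_true, one_mul]
      exact Or.inr ⟨h1.1 rfl, h2.1 rfl⟩
    · simp only [stackSign, one_ne_zero, if_false, neg_one_mul]
      exact Or.inl ⟨h1.2 rfl, h2.2 rfl⟩
  · have := (hx.pathHeight_of_ne hd).2
    omega

lemma pathHeight_ne_of_extremal (hx : IsPath h w x dir kd) {a b : ℕ} (hab : x (b + 1) = x a)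
    (h1 : x a < x (a + 1)) (h2 : x a < x b) (h3 : x (a + 1) ≠ x b) :
    pathHeight x dir kd a ≠ pathHeight x dir kd b := by
  have ea := hx.edge a
  have eb := (hx.edge b).symm
  rw [hab] at eb
  by_cases hda : dir a = .mat
  · by_cases hdb : dir b = .mat
    · rw [hda] at ea
      rw [hdb] at eb
      exact (h3 (ea.unique eb)).elim
    · obtain ⟨s, lo, hi, hm, he, -⟩ := hx.pathHeight_of_mat hda
      have := hm.1
      rw [he, (hx.pathHeight_of_ne hdb).1]
      obtain rfl | rfl : s = 0 ∨ s = 1 := by omega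
      · simp [stackSign]
        omega
      · simp [stackSign]
        omega
  · by_cases hdb : dir b = .mat
    · obtain ⟨s, lo, hi, hm, he, -⟩ := hx.pathHeight_of_mat hdb
      have := hm.1
      rw [he, (hx.pathHeight_of_ne hda).1]
      obtain rfl | rfl : s = 0 ∨ s = 1 := by omega
      · simp [stackSign]
        omega
      · simp [stackSign]
        omega
    · have := (hx.pathHeight_of_ne hda).2
      have := (hx.pathHeight_of_ne hdb).2
      omega

/-- A simple closed walk in a 2-stack nested word is not a proper power of a walk whose
directions and letters it repeats. -/
theorem eq_one_of_simple (hx : IsPath h w x dir kd) {m n : ℕ} (hN : 3 ≤ m * n)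
    (hper : ∀ a, x (a + m * n) = x a) (hinj : ∀ a b, x a = x b → a ≡ b [MOD m * n])
    (hdir : ∀ a, dir (a + n) = dir a) (hkd : ∀ a, kd (a + n) = kd a) : m = 1 := by
  set N := m * n with hNdef
  have hlt_of : ∀ a k, 0 < k → k < N → x (a + k) ≠ x a := by
    intro a k hk hkN he
    have h1 := hinj _ _ he
    have h2 : k ≡ 0 [MOD N] := Nat.ModEq.add_left_cancel' a h1
    rw [Nat.ModEq, Nat.mod_eq_of_lt hkN, Nat.zero_mod] at h2
    omega
  have hdirN : ∀ a, dir (a + N) = dir a := by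
    intro a
    have : Function.Periodic dir n := hdir
    exact this.nat_mul m a
  have hkdN : ∀ a, kd (a + N) = kd a := by
    intro a
    have : Function.Periodic kd n := hkd
    exact this.nat_mul m a
  set e := pathHeight x dir kd with he
  have heN : ∀ a, e (a + N) = e a := by
    intro a
    rw [he, pathHeight, pathHeight, hdirN, hkdN, hper, add_right_comm, hper]
  set G : ℕ → ℤ := fun a => ltInd (e a) (e (a + 1)) *
      (ltInd (x a) (x (a + 1)) - ltInd (x (a + 1)) (x (a + 2))) with hG
  have hGN : ∀ a, G (a + N) = G a := by
    intro a
    simp only [hG]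
    rw [heN, hper, show a + N + 1 = a + 1 + N by ring, show a + N + 2 = a + 2 + N by ring, heN,
      hper, hper]
  have hGn : ∀ a, G (a + n) = G a := by
    intro a
    simp only [hG]
    rw [he, hx.ltInd_pathHeight (hlt_of _ 2 (by omega) (by omega)),
      hx.ltInd_pathHeight (hlt_of _ 2 (by omega) (by omega)), hx.ltInd_eq (a + n),
      hx.ltInd_eq (a + n + 1), hx.ltInd_eq a, hx.ltInd_eq (a + 1), add_right_comm a n 1,
        hdir, hkd, hdir, hkd]
  obtain ⟨k, hk⟩ : ∃ k, ∀ a, x k ≤ x a := by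
    obtain ⟨_, ⟨k, rfl⟩, hk⟩ := WellFounded.has_min Nat.lt_wfRel.wf (Set.range x) ⟨_, 0, rfl⟩
    exact ⟨k, fun a => not_lt.1 (hk _ ⟨a, rfl⟩)⟩
  have hkl : ∀ a, x (a + k) ≠ x k → x k < x (a + k) := fun a ha => lt_of_le_of_ne (hk _) ha.symm
  have hturn := turning_number (N := N) (p := fun a => (x (a + k) : ℤ)) (e := fun a => e (a + k))
    (by simp only [zero_add]; rw [add_comm N k, hper])
    (by rw [show N + 1 + k = 1 + k + N by ring, hper])
    (by simp only [zero_add]; rw [add_comm N k, heN])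
    (by
      intro a b ha hb hab
      have h1 := hinj _ _ (Int.ofNat_inj.1 hab)
      have h2 : a ≡ b [MOD N] := Nat.ModEq.add_right_cancel' k h1
      rwa [Nat.ModEq, Nat.mod_eq_of_lt ha, Nat.mod_eq_of_lt hb] at h2)
    (by
      intro a ha haN
      simp only [zero_add, Nat.cast_lt]
      exact hkl _ (by rw [add_comm]; exact hlt_of k a ha haN))
    (by
      simp only [zero_add]
      have e1 : N - 1 + k + 1 = k + N := by omega
      refine hx.pathHeight_ne_of_extremal (by rw [e1, hper]) ?_ ?_ ?_
      · rw [add_comm]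
        exact hkl _ (by rw [add_comm]; exact hlt_of k 1 (by omega) (by omega))
      · exact hkl _ (by rw [add_comm]; exact hlt_of k (N - 1) (by omega) (by omega))
      · have := hlt_of (k + 1) (N - 2) (by omega) (by omega)
        rw [show k + 1 + (N - 2) = N - 1 + k by omega] at this
        exact this.symm)
    (by
      intro a b _ _ _ _ hb
      simp only [Nat.cast_lt] at hb ⊢
      rw [add_right_comm] at hb ⊢
      rw [add_right_comm b 1 k] at hb
      exact hx.noncrossing hb)
  have hsum : ∑ a ∈ Finset.range N, ltInd (e (a + k)) (e (a + 1 + k)) *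
      (ltInd (x (a + k)) (x (a + 1 + k)) - ltInd (x (a + 1 + k)) (x (a + 2 + k))) =
      m * ∑ a ∈ Finset.range n, G a := by
    rw [← sum_range_mul_of_periodic hGn m, ← hNdef, ← sum_range_add_of_periodic hGN k]
    refine Finset.sum_congr rfl fun a _ => ?_
    simp only [hG]
    rw [add_right_comm a 1 k, add_right_comm a 2 k]
  rw [hsum] at hturn
  rcases hturn with ht | ht
  · have := Int.isUnit_iff.1 (IsUnit.of_mul_eq_one _ ht)
    omega
  · have := Int.isUnit_iff.1 (IsUnit.of_mul_eq_one (a := (m : ℤ))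
      (-∑ a ∈ Finset.range n, G a) (by linarith))
    omega

end IsPath

end NestedWord

namespace NestedWord

variable {A C : Type} {h : CRAlphabet 2 A} {w : List A}

lemma exists_walk_take {u : List Dir} {i j : ℕ} (hu : walk h w u i = some j) (b : ℕ) :
    ∃ z, walk h w (u.take b) i = some z ∧ walk h w (u.drop b) z = some j := by
  rw [← List.take_append_drop b u, walk_append, Option.bind_eq_some_iff] at hu
  exact hu

/-- If the colours of neighbouring positions are distinct, and if two positions of the
same colour that are joined by a short walk have the same labelled surroundings, then a short
walk is closed as soon as its endpoints have the same colour. -/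
theorem eq_of_color_eq (lab : ℕ → A × C) (hlet : ∀ i < w.length, w[i]? = some (lab i).1) {M R : ℕ}
    (hMR : 2 * R ≤ M) (hedge : ∀ d i j, Edge h w d i j → (lab i).2 ≠ (lab j).2)
    (hview : ∀ i j u, i < w.length → walk h w u i = some j → (lab i).2 = (lab j).2 →
      ∀ s : List Dir, u.length + s.length ≤ M →
        (walk h w s j).map lab = (walk h w s i).map lab) :
    ∀ n ≤ R, ∀ (u : List Dir) (i j : ℕ), u.length = n → i < w.length → walk h w u i = some j →
      (lab i).2 = (lab j).2 → i = j := by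
  intro n
  induction n using Nat.strong_induction_on with
  | _ n ih =>
  intro hnR u i j hun hi hu hcol
  by_contra hij
  have hn2 : 2 ≤ n := by
    rcases u with _ | ⟨d, _ | ⟨d', u⟩⟩
    · exact (hij (by simpa using hu)).elim
    · rw [walk_singleton, step_eq_some] at hu
      exact (hedge d i j hu hcol).elim
    · simp only [List.length_cons] at hun
      omega
  -- the positions reached by repeating the walk
  let y : ℕ → ℕ := fun k => Nat.rec i (fun _ z => (walk h w u z).getD 0) k
  have hy0 : y 0 = i := rfl
  have hysucc : ∀ k, y (k + 1) = (walk h w u (y k)).getD 0 := fun _ => rfl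
  have hyaux : ∀ k, (∀ s : List Dir, s.length ≤ n →
      (walk h w s (y k)).map lab = (walk h w s i).map lab) →
      walk h w u (y k) = some (y (k + 1)) ∧ lab (y (k + 1)) = lab j := by
    intro k hk
    have h1 := hk u hun.le
    rw [hu, Option.map_some, Option.map_eq_some_iff] at h1
    obtain ⟨z, hz, hlab⟩ := h1
    have : y (k + 1) = z := by rw [hysucc, hz, Option.getD_some]
    rw [this]
    exact ⟨hz, hlab⟩
  have hy : ∀ k, y k < w.length ∧ ∀ s : List Dir, s.length ≤ n →
      (walk h w s (y k)).map lab = (walk h w s i).map lab := by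
    intro k
    induction k with
    | zero => exact ⟨hi, fun _ _ => rfl⟩
    | succ k ihk =>
      obtain ⟨h1, h2⟩ := hyaux k ihk.2
      refine ⟨walk_lt ihk.1 h1, fun s hs => ?_⟩
      rw [← ihk.2 s hs]
      refine hview (y k) (y (k + 1)) u ihk.1 h1 ?_ s (by omega)
      have h3 := ihk.2 [] (by simp)
      simp only [walk_nil, Option.map_some, Option.some_inj] at h3
      rw [h2, h3, hcol]
  have hywalk : ∀ k, walk h w u (y k) = some (y (k + 1)) := fun k => (hyaux k (hy k).2).1
  have hy1 : y 1 = j := by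
    have := hywalk 0
    rw [hy0, hu] at this
    simpa using this.symm
  have hback : ∀ a t, y a = y (a + t) → y t = i := by
    intro a t hat
    induction a with
    | zero => rw [← hy0, hat, zero_add]
    | succ a iha =>
      refine iha (walk_inj (hywalk a) ?_)
      rw [hywalk, hat, add_right_comm]
  have hexists : ∃ m, 0 < m ∧ y m = i := by
    obtain ⟨a, b, hab, he⟩ := Finite.exists_ne_map_eq_of_infinite
      (fun k => (⟨y k, (hy k).1⟩ : Fin w.length))
    rw [Fin.mk.injEq] at he
    rcases lt_or_gt_of_ne hab with hlt | hlt
    · exact ⟨b - a, by omega, hback a _ (by rw [he]; congr 1; omega)⟩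
    · exact ⟨a - b, by omega, hback b _ (by rw [← he]; congr 1; omega)⟩
  obtain ⟨m, ⟨hm0, hmi⟩, hmin⟩ : ∃ m, (0 < m ∧ y m = i) ∧ ∀ t, 0 < t → y t = i → m ≤ t :=
    ⟨sInf {m | 0 < m ∧ y m = i}, Nat.sInf_mem hexists, fun t h1 h2 => Nat.sInf_le ⟨h1, h2⟩⟩
  have hm1 : m ≠ 1 := by
    rintro rfl
    exact hij (hmi.symm.trans hy1)
  have hyper : ∀ k, y (k + m) = y k := by
    intro k
    induction k with
    | zero => rw [zero_add, hmi, hy0]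
    | succ k ihk => rw [add_right_comm, hysucc, ihk, hysucc]
  have hyinj : ∀ a b, y a = y b → a ≡ b [MOD m] := by
    have hdvd : ∀ t, y t = i → m ∣ t := by
      intro t ht
      have hper : Function.Periodic y m := hyper
      have h1 : y (t % m) = i := by rw [hper.map_mod_nat, ht]
      by_contra hnd
      have h2 := hmin (t % m) (Nat.pos_of_ne_zero fun h0 => hnd (Nat.dvd_of_mod_eq_zero h0)) h1
      have := Nat.mod_lt t hm0
      omega
    intro a b hab
    rcases le_total a b with hle | hle
    · obtain ⟨t, rfl⟩ := Nat.exists_eq_add_of_le hle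
      exact (Nat.modEq_iff_dvd' hle).2 (by simpa using hdvd t (hback a t hab))
    · obtain ⟨t, rfl⟩ := Nat.exists_eq_add_of_le hle
      exact ((Nat.modEq_iff_dvd' hle).2 (by simpa using hdvd t (hback b t hab.symm))).symm
  -- the positions visited along the repeated walk
  let z : ℕ → ℕ → ℕ := fun q b => (walk h w (u.take b) (y q)).getD 0
  have hz : ∀ q b, walk h w (u.take b) (y q) = some (z q b) := by
    intro q b
    obtain ⟨t, ht, -⟩ := exists_walk_take (hywalk q) b
    simp only [z, ht, Option.getD_some]
  have hz0 : ∀ q, z q 0 = y q := fun q => by simp [z]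
  have hzn : ∀ q, z q n = y (q + 1) := by
    intro q
    have h1 := hz q n
    rw [List.take_of_length_le hun.le, hywalk] at h1
    simpa using h1.symm
  have hzlab : ∀ q b, lab (z q b) = lab (z 0 b) := by
    intro q b
    have h1 := (hy q).2 (u.take b) (by simp [hun])
    have h2 := hz 0 b
    rw [hy0] at h2
    rw [hz, h2] at h1
    simpa using h1
  have hzlt : ∀ q b, z q b < w.length := fun q b => walk_lt (hy q).1 (hz q b)
  have hzcol : ∀ b b', b < b' → b' < n → (lab (z 0 b)).2 ≠ (lab (z 0 b')).2 := by
    intro b b' hb hb' he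
    have h1 := hz 0 b
    have h2 := hz 0 b'
    rw [hy0] at h1 h2
    have h3 : walk h w ((u.take b').drop b) (z 0 b) = some (z 0 b') := by
      obtain ⟨t, ht, ht'⟩ := exists_walk_take h2 b
      rw [List.take_take, min_eq_left hb.le, h1] at ht
      obtain rfl : z 0 b = t := by simpa using ht
      exact ht'
    have h4 := ih (b' - b) (by omega) (by omega) _ _ _ (by simp; omega) (hzlt 0 b) h3 he
    obtain ⟨t, ht, ht'⟩ := exists_walk_take hu b'
    obtain rfl : z 0 b' = t := by simpa [h2] using ht
    have h5 : walk h w (u.take b ++ u.drop b') i = some j := by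
      rw [walk_append_of_eq _ h1, h4, ht']
    exact hij (ih (b + (n - b')) (by omega) (by omega) _ _ _ (by simp; omega) hi h5 hcol)
  have hzedge : ∀ q b, b < n → Edge h w (u.getD b .next) (z q b) (z q (b + 1)) := by
    intro q b hb
    have h1 := hz q (b + 1)
    have h2 : u[b]? = some (u.getD b .next) := by
      rw [List.getD_eq_getElem _ _ (hun ▸ hb), List.getElem?_eq_getElem]
    rw [List.take_add_one, h2, Option.toList_some, walk_append_of_eq _ (hz q b), walk_singleton,
      step_eq_some] at h1
    exact h1
  have hn0 : 0 < n := by omega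
  have hpath : IsPath h w (fun a => z (a / n) (a % n)) (fun a => u.getD (a % n) .next)
      (fun a => h.kind (lab (z (a / n) (a % n))).1) := by
    refine ⟨fun a => ?_, fun a => ⟨_, hlet _ (hzlt _ _), rfl⟩⟩
    have h1 := hzedge (a / n) (a % n) (Nat.mod_lt _ hn0)
    rcases Nat.lt_or_ge (a % n + 1) n with hlt | hge
    · have e1 : (a + 1) % n = a % n + 1 := by
        rw [Nat.add_mod, Nat.mod_eq_of_lt (show 1 < n by omega), Nat.mod_eq_of_lt hlt]
      have e2 : (a + 1) / n = a / n := by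
        rw [Nat.div_eq_iff hn0]
        have := Nat.div_add_mod a n
        have h3 : a / n * n = n * (a / n) := mul_comm _ _
        omega
      simpa only [e1, e2] using h1
    · have e0 : a % n + 1 = n := le_antisymm (Nat.mod_lt _ hn0) hge
      have e3 : a + 1 = n * (a / n + 1) := by
        have := Nat.div_add_mod a n
        rw [mul_add, mul_one]
        omega
      have e1 : (a + 1) % n = 0 := by rw [e3, Nat.mul_mod_right]
      have e2 : (a + 1) / n = a / n + 1 := by rw [e3, Nat.mul_div_cancel_left _ hn0]
      simp only [e1, e2]
      rw [e0, (hzn (a / n)).trans (hz0 (a / n + 1)).symm] at h1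
      exact h1
  refine hm1 (hpath.eq_one_of_simple (n := n) ?_ (fun a => ?_) (fun a b hab => ?_) (fun a => ?_)
    (fun a => ?_))
  · nlinarith [show 2 ≤ m by omega]
  · simp only [Nat.add_mul_div_right _ _ hn0, Nat.add_mul_mod_self_right, z, hyper]
  · have hmod : a % n = b % n := by
      have hc : (lab (z 0 (a % n))).2 = (lab (z 0 (b % n))).2 := by
        rw [← hzlab (a / n), ← hzlab (b / n)]
        exact congrArg (fun t => (lab t).2) hab
      rcases lt_trichotomy (a % n) (b % n) with hlt | he | hlt
      · exact (hzcol _ _ hlt (Nat.mod_lt _ hn0) hc).elim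
      · exact he
      · exact (hzcol _ _ hlt (Nat.mod_lt _ hn0) hc.symm).elim
    have h1 := hz (a / n) (a % n)
    have h2 := hz (b / n) (b % n)
    rw [hab, hmod] at h1
    have h3 := hyinj _ _ (walk_inj h1 h2)
    have h4 := (h3.mul_left' n).add_right (a % n)
    rw [Nat.div_add_mod, hmod, Nat.div_add_mod, mul_comm] at h4
    exact h4
  · simp only [Nat.add_mod_right]
  · simp only [Nat.add_mod_right, hzlab _ (a % n)]

end NestedWord

namespace NestedWord

variable {K : ℕ} {A : Type} (h : CRAlphabet K A)

/-- The words of directions of length at most `M`. -/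
abbrev DirWord (M : ℕ) : Type := {u : List Dir // u.length ≤ M}

instance (M : ℕ) : Finite (DirWord M) := (List.finite_length_le Dir M).to_subtype

/-- Greedy colouring: boundedly many colours suffice to separate any two positions of a nested
word that are joined by a short walk. -/
theorem exists_coloring (w : List A) (M : ℕ) : ∃ κ : ℕ → Option (DirWord M),
    ∀ i j u, i < w.length → u.length ≤ M → walk h w u i = some j → i ≠ j → κ i ≠ κ j := by
  have key : ∀ n, ∃ κ : ℕ → Option (DirWord M), ∀ i j u, i < n → j < n → u.length ≤ M →
      walk h w u i = some j → i ≠ j → κ i ≠ κ j := by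
    intro n
    induction n with
    | zero => exact ⟨fun _ => none, fun i _ _ hi => by omega⟩
    | succ n ih =>
      obtain ⟨κ, hκ⟩ := ih
      let f : DirWord M → Option (DirWord M) := fun u => κ ((walk h w u.1 n).getD 0)
      have hf : ¬ Function.Surjective f := by
        intro hs
        have := Nat.card_le_card_of_surjective f hs
        rw [Finite.card_option] at this
        omega
      simp only [Function.Surjective, not_forall, not_exists] at hf
      obtain ⟨c, hc⟩ := hf
      have hcj : ∀ j u, u.length ≤ M → walk h w u n = some j → κ j ≠ c := by
        intro j u hu hw
        simpa [f, hw] using hc ⟨u, hu⟩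
      refine ⟨Function.update κ n c, fun i j u hi hj hu hw hij => ?_⟩
      by_cases hin : i = n
      · subst hin
        rw [Function.update_self, Function.update_of_ne hij.symm]
        exact (hcj j u hu hw).symm
      · rw [Function.update_of_ne hin]
        by_cases hjn : j = n
        · subst hjn
          rw [Function.update_self]
          exact hcj i (revWord u) (by simpa using hu) (walk_revWord_of_eq hw)
        · rw [Function.update_of_ne hjn]
          exact hκ i j u (by omega) (by omega) hu hw hij
  obtain ⟨κ, hκ⟩ := key w.length
  exact ⟨κ, fun i j u hi hu hw => hκ i j u hi (walk_lt hi hw) hu hw⟩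

end NestedWord

namespace NestedWord

variable {K : ℕ} {A Λ : Type} (h : CRAlphabet K A)

/-- The states of the automaton guessing a labelling: the letter and the label of the current
position together with the labels of its neighbours, or `none` before the first letter. -/
abbrev LocalState (A Λ : Type) : Type := Option (A × Λ × (Dir → Option Λ))

/-- The part of a transition checking the local constraint and the labels of two consecutive
positions. -/
def LocalStep (Φ : A → Λ → (Dir → Option Λ) → Prop) (q : LocalState A Λ) (a : A)
    (q' : LocalState A Λ) (l : Λ) (n : Dir → Option Λ) : Prop :=
  q' = some (a, l, n) ∧ Φ a l n ∧ n .prev = q.map (fun p => p.2.1) ∧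
    ∀ p, q = some p → p.2.2 .next = some l

/-- The automaton guessing a labelling of the positions that satisfies a local constraint. -/
def localAut (Φ : A → Λ → (Dir → Option Λ) → Prop) : GMNWA K A (LocalState A Λ) where
  delta1 q a q' := ∃ l n, LocalStep Φ q a q' l n ∧ ((∀ s, h.kind a ≠ .call s) → n .mat = none)
  delta2 qj q a q' := ∃ l n, LocalStep Φ q a q' l n ∧
    ∃ p, qj = some p ∧ n .mat = some p.2.1 ∧ p.2.2 .mat = some l
  qI := {none}
  qF := {q | ∃ p, q = some p ∧ p.2.2 .next = none}
  qC := {q | ∃ p, q = some p ∧ p.2.2 .mat ≠ none ∧ ∃ s, h.kind p.1 = .call s}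

variable {h} {w : List A}

lemma muAny_call_kind {i j : ℕ} (hm : MuAny h w i j) {a : A} (ha : w[i]? = some a) :
    ∃ s, h.kind a = .call s := by
  obtain ⟨s, hm⟩ := hm
  obtain ⟨b, hb, hk⟩ := matched_call_kind hm
  obtain rfl : a = b := by simpa [ha] using hb
  exact ⟨s, hk⟩

lemma muAny_not_call_kind {i j : ℕ} (hm : MuAny h w j i) {a : A} (ha : w[i]? = some a) (s : Fin K) :
    h.kind a ≠ .call s := by
  obtain ⟨s', hm⟩ := hm
  obtain ⟨b, hb, hk⟩ := matched_ret_kind hm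
  obtain rfl : a = b := by simpa [ha] using hb
  simp [hk]

lemma step_prev_zero : step h w .prev 0 = none := by
  rw [step_eq_none]
  rintro j ⟨hj, -⟩
  omega

lemma step_prev_succ {i : ℕ} (hi : i + 1 < w.length) : step h w .prev (i + 1) = some i :=
  step_eq_some.2 ⟨rfl, hi⟩

lemma step_next {i : ℕ} (hi : i + 1 < w.length) : step h w .next i = some (i + 1) :=
  step_eq_some.2 ⟨rfl, hi⟩

lemma step_next_eq_none {i : ℕ} : step h w .next i = none ↔ w.length ≤ i + 1 := by
  rw [step_eq_none]
  refine ⟨fun hs => ?_, ?_⟩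
  · by_contra! hlt
    exact hs _ ⟨rfl, hlt⟩
  · rintro hle j ⟨rfl, hj⟩
    omega

variable (Φ : A → Λ → (Dir → Option Λ) → Prop)

lemma exists_run_of_labelling (hw : w ≠ []) {σ : ℕ → Λ}
    (hσ : ∀ i a, w[i]? = some a → Φ a (σ i) (fun d => (step h w d i).map σ)) :
    ∃ ρ, gRun h (localAut h Φ) w ρ ∧ gAcc h (localAut h Φ) w ρ := by
  have hpos : 0 < w.length := List.length_pos_iff.2 hw
  let ρ : ℕ → LocalState A Λ :=
    fun i => (w[i]?).map fun a => (a, σ i, fun d => (step h w d i).map σ)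
  have hρ : ∀ i (hi : i < w.length),
      ρ i = some (w[i], σ i, fun d => (step h w d i).map σ) := by
    intro i hi
    simp [ρ, hi]
  have hget : ∀ i (hi : i < w.length), w[i]? = some w[i] := fun i hi => List.getElem?_eq_getElem hi
  have hmat : ∀ i (hi : i < w.length), (¬ ∃ j, MuAny h w j i) → (∀ s, h.kind w[i] ≠ .call s) →
      step h w .mat i = none := by
    intro i hi h1 h2
    rw [step_eq_none]
    rintro j (hj | hj)
    · obtain ⟨s, hs⟩ := muAny_call_kind hj (hget i hi)
      exact h2 s hs
    · exact h1 ⟨j, hj⟩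
  refine ⟨ρ, ⟨⟨none, rfl, w[0], hget 0 hpos, σ 0, _, ⟨hρ 0 hpos, hσ _ _ (hget 0 hpos), ?_, ?_⟩,
    ?_⟩, ?_⟩, ?_, ?_⟩
  · simp [step_prev_zero]
  · simp
  · intro hk
    rw [hmat 0 hpos (fun ⟨j, hj⟩ => by have := muAny_lt hj; omega) hk, Option.map_none]
  · rintro (_ | i) h0 hi
    · omega
    have hstep : LocalStep Φ (ρ i) w[i + 1] (ρ (i + 1)) (σ (i + 1))
        (fun d => (step h w d (i + 1)).map σ) := by
      refine ⟨hρ _ hi, hσ _ _ (hget _ hi), ?_, ?_⟩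
      · simp only [step_prev_succ hi, hρ i (by omega), Option.map_some]
      · rintro p hp
        rw [hρ i (by omega), Option.some_inj] at hp
        simp only [← hp, step_next hi, Option.map_some]
    refine ⟨w[i + 1], hget _ hi, ?_⟩
    by_cases hex : ∃ j, MuAny h w j (i + 1)
    · obtain ⟨j, hj⟩ := hex
      have hji := muAny_lt hj
      refine Or.inl ⟨j, hj, _, _, hstep, _, hρ j (by omega), ?_, ?_⟩
      · have : step h w .mat (i + 1) = some j := step_eq_some.2 (Or.inr hj)
        simp only [this, Option.map_some]
      · have : step h w .mat j = some (i + 1) := step_eq_some.2 (Or.inl hj)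
        simp only [this, Option.map_some]
    · refine Or.inr ⟨hex, _, _, hstep, fun hk => ?_⟩
      rw [hmat _ hi hex hk, Option.map_none]
  · refine ⟨_, hρ _ (by omega), ?_⟩
    have : step h w .next (w.length - 1) = none := step_next_eq_none.2 (by omega)
    simp only [this, Option.map_none]
  · rintro i hi ⟨p, hp, hne, s, hs⟩
    rw [hρ i hi, Option.some_inj] at hp
    subst hp
    simp only [ne_eq, Option.map_eq_none_iff] at hne
    obtain ⟨j, hj⟩ := Option.ne_none_iff_exists'.1 hne
    rcases step_eq_some.1 hj with hj | hj
    · exact ⟨j, hj⟩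
    · exact (muAny_not_call_kind hj (hget i hi) s hs).elim

lemma exists_labelling_of_run (hw : w ≠ []) {ρ : ℕ → LocalState A Λ}
    (hrun : gRun h (localAut h Φ) w ρ) (hacc : gAcc h (localAut h Φ) w ρ) :
    ∃ σ : ℕ → Λ, ∀ i a, w[i]? = some a → Φ a (σ i) (fun d => (step h w d i).map σ) := by
  have hpos : 0 < w.length := List.length_pos_iff.2 hw
  obtain ⟨⟨q, rfl, a₀, ha₀, l₀, n₀, h₀, hm₀⟩, hrun⟩ := hrun
  obtain ⟨hF, hC⟩ := hacc
  have hinv : ∀ i < w.length, ∃ a l n, w[i]? = some a ∧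
      LocalStep Φ (if i = 0 then none else ρ (i - 1)) a (ρ i) l n ∧
      ((¬ ∃ j, MuAny h w j i) → (∀ s, h.kind a ≠ .call s) → n .mat = none) ∧
      ∀ j, MuAny h w j i → ∃ p, ρ j = some p ∧ n .mat = some p.2.1 ∧ p.2.2 .mat = some l := by
    intro i hi
    rcases Nat.eq_zero_or_pos i with rfl | h0
    · exact ⟨a₀, l₀, n₀, ha₀, h₀, fun _ => hm₀, fun j hj => by have := muAny_lt hj; omega⟩
    · obtain ⟨a, ha, ⟨j, hj, l, n, hstep, hp⟩ | ⟨hno, l, n, hstep, hk⟩⟩ := hrun i h0 hi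
      · refine ⟨a, l, n, ha, by rwa [if_neg h0.ne'], fun hno => (hno ⟨j, hj⟩).elim, ?_⟩
        intro j' hj'
        rwa [muAny_left_unique hj' hj]
      · exact ⟨a, l, n, ha, by rwa [if_neg h0.ne'], fun _ => hk, fun j hj => (hno ⟨j, hj⟩).elim⟩
  let σ : ℕ → Λ := fun i => ((ρ i).map (fun p => p.2.1)).getD l₀
  have hσ : ∀ {i : ℕ} {p : A × Λ × (Dir → Option Λ)}, ρ i = some p → p.2.1 = σ i := by
    intro i p hp
    simp [σ, hp]
  refine ⟨σ, fun i a ha => ?_⟩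
  have hi : i < w.length := (List.getElem?_eq_some_iff.1 ha).1
  obtain ⟨a', l, n, ha', ⟨hρ, hΦ, hprev, -⟩, hnone, hret⟩ := hinv i hi
  obtain rfl : a = a' := by simpa [ha] using ha'
  obtain rfl : l = σ i := hσ hρ
  convert hΦ using 1
  funext d
  cases d
  · rw [hprev]
    rcases i with _ | i
    · simp [step_prev_zero]
    · obtain ⟨_, _, _, -, ⟨hρ', -⟩, -⟩ := hinv i (by omega)
      simp [step_prev_succ hi, hρ', ← hσ hρ']
  · rcases Nat.lt_or_ge (i + 1) w.length with hlt | hge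
    · obtain ⟨_, l', _, -, ⟨hρ', -, -, hnext⟩, -⟩ := hinv (i + 1) hlt
      obtain rfl : l' = σ (i + 1) := hσ hρ'
      have := hnext _ hρ
      simp only at this
      simp [step_next hlt, this]
    · obtain rfl : i = w.length - 1 := by omega
      obtain ⟨p, hp, hnx⟩ := hF
      rw [hρ, Option.some_inj] at hp
      subst hp
      simp only at hnx
      rw [hnx, step_next_eq_none.2 hge, Option.map_none]
  · by_cases h1 : ∃ j, MuAny h w j i
    · obtain ⟨j, hj⟩ := h1
      obtain ⟨p, hp, hm, -⟩ := hret j hj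
      have : step h w .mat i = some j := step_eq_some.2 (Or.inr hj)
      rw [hm, this, Option.map_some, hσ hp]
    by_cases h2 : ∃ j, MuAny h w i j
    · obtain ⟨j, hj⟩ := h2
      obtain ⟨_, l', _, -, ⟨hρ', -⟩, -, hret'⟩ := hinv j (muAny_lt hj).2
      obtain rfl : l' = σ j := hσ hρ'
      obtain ⟨p, hp, -, hm⟩ := hret' i hj
      rw [hρ, Option.some_inj] at hp
      subst hp
      have : step h w .mat i = some j := step_eq_some.2 (Or.inl hj)
      rw [this, Option.map_some]
      exact hm.symm
    · have : step h w .mat i = none := by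
        rw [step_eq_none]
        rintro j (hj | hj)
        exacts [h2 ⟨j, hj⟩, h1 ⟨j, hj⟩]
      rw [this, Option.map_none]
      symm
      by_cases hk : ∃ s, h.kind a = .call s
      · by_contra hne
        exact h2 (hC i hi ⟨_, hρ, hne, hk⟩)
      · exact hnone h1 (not_exists.1 hk)

/-- The automaton recognizes the nested words having a labelling that satisfies the local
constraint. -/
theorem mem_gLang_localAut : w ∈ gLang h (localAut h Φ) ↔ w ≠ [] ∧ ∃ σ : ℕ → Λ, ∀ i a,
    w[i]? = some a → Φ a (σ i) (fun d => (step h w d i).map σ) :=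
  and_congr_right fun hw => ⟨fun ⟨_, hrun, hacc⟩ => exists_labelling_of_run Φ hw hrun hacc,
    fun ⟨_, hσ⟩ => exists_run_of_labelling Φ hw hσ⟩

end NestedWord

namespace NestedWord

variable {K : ℕ} {A : Type} {h : CRAlphabet K A} {v w : List A}

lemma distLE_iff_exists_walk {r i j : ℕ} :
    DistLE h w r i j ↔ ∃ u : List Dir, u.length ≤ r ∧ walk h w u i = some j := by
  induction r generalizing i with
  | zero =>
    constructor
    · rintro rfl
      exact ⟨[], le_rfl, rfl⟩
    · rintro ⟨u, hu, hw⟩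
      obtain rfl : u = [] := List.length_eq_zero_iff.1 (by omega)
      exact Option.some_inj.1 hw
  | succ r ih =>
    constructor
    · rintro (rfl | ⟨k, hadj, hk⟩)
      · exact ⟨[], by simp, rfl⟩
      · obtain ⟨d, hd⟩ := adj_iff_exists_edge.1 hadj
        obtain ⟨u, hu, hw⟩ := ih.1 hk
        refine ⟨d :: u, by simpa using hu, ?_⟩
        rw [walk_cons, step_eq_some.2 hd, Option.bind_some, hw]
    · rintro ⟨_ | ⟨d, u⟩, hu, hw⟩
      · exact Or.inl (by simpa using hw)
      · rw [walk_cons, Option.bind_eq_some_iff] at hw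
        obtain ⟨k, hk, hw⟩ := hw
        exact Or.inr ⟨k, adj_iff_exists_edge.2 ⟨d, step_eq_some.1 hk⟩,
          ih.2 ⟨u, by simpa using hu, hw⟩⟩

lemma walk_append_revWord {u u' : List Dir} {i : ℕ} : walk h w (u ++ revWord u') i = some i ↔
    ∃ j, walk h w u i = some j ∧ walk h w u' i = some j := by
  simp only [walk_append, Option.bind_eq_some_iff, walk_revWord]

lemma matched_iff_edge {s : Fin K} {j k : ℕ} :
    Matched h w s j k ↔ Edge h w .mat j k ∧ ∃ a, w[j]? = some a ∧ h.kind a = .call s := by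
  refine ⟨fun hm => ⟨Or.inl ⟨s, hm⟩, matched_call_kind hm⟩, ?_⟩
  rintro ⟨⟨s', hm⟩ | hm, a, ha, hk⟩
  · obtain ⟨a', ha', hk'⟩ := matched_call_kind hm
    obtain rfl : a = a' := by simpa [ha] using ha'
    obtain rfl : s = s' := by simpa [hk] using hk'
    exact hm
  · exact (muAny_not_call_kind hm ha s hk).elim

/-- The sphere around a position is determined by the letters along short walks from it and by
which of the short walks are closed. -/
theorem sphIso_of_walks {r c i : ℕ} (hc : c < v.length) (hi : i < w.length)
    (hlet : ∀ u : List Dir, u.length ≤ 2 * r + 1 →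
      (walk h v u c).bind (v[·]?) = (walk h w u i).bind (w[·]?))
    (hclosed : ∀ u : List Dir, u.length ≤ 2 * r + 1 →
      (walk h v u c = some c ↔ walk h w u i = some i)) : SphIso h r v c w i := by
  have hmeet : ∀ u u' : List Dir, u.length + u'.length ≤ 2 * r + 1 →
      ((∃ j, walk h v u c = some j ∧ walk h v u' c = some j) ↔
        ∃ j, walk h w u i = some j ∧ walk h w u' i = some j) := by
    intro u u' hu
    rw [← walk_append_revWord, ← walk_append_revWord]
    exact hclosed _ (by simpa using hu)
  have hex : ∀ j, ∃ k, ∀ u : List Dir, u.length ≤ r → walk h v u c = some j →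
      walk h w u i = some k := by
    intro j
    by_cases hj : ∃ u : List Dir, u.length ≤ r ∧ walk h v u c = some j
    · obtain ⟨u, hu, huj⟩ := hj
      obtain ⟨k, hk, -⟩ := (hmeet u u (by omega)).1 ⟨j, huj, huj⟩
      refine ⟨k, fun u' hu' huj' => ?_⟩
      obtain ⟨k', hk1, hk2⟩ := (hmeet u u' (by omega)).1 ⟨j, huj, huj'⟩
      obtain rfl : k = k' := by simpa [hk] using hk1
      exact hk2
    · exact ⟨0, fun u hu huj => (hj ⟨u, hu, huj⟩).elim⟩
  choose f hf using hex
  have hlabel : ∀ j ∈ ball h v r c, v[j]? = w[f j]? := by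
    intro j hj
    obtain ⟨u, hu, huj⟩ := distLE_iff_exists_walk.1 hj
    simpa [huj, hf j u hu huj] using hlet u (by omega)
  have hedge : ∀ d, ∀ j ∈ ball h v r c, ∀ k ∈ ball h v r c,
      (Edge h v d j k ↔ Edge h w d (f j) (f k)) := by
    intro d j hj k hk
    obtain ⟨u, hu, huj⟩ := distLE_iff_exists_walk.1 hj
    obtain ⟨u', hu', huk⟩ := distLE_iff_exists_walk.1 hk
    have := hmeet (u ++ [d]) u' (by simp; omega)
    simpa [walk_append_of_eq _ huj, walk_append_of_eq _ (hf j u hu huj), huk, hf k u' hu' huk,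
      step_eq_some] using this
  refine ⟨f, hc, hi, ?_, ⟨?_, ?_, ?_⟩, hlabel,
    fun j hj k hk => ⟨hedge .next j hj k hk, fun s => ?_⟩⟩
  · simpa using (hf c [] (by simp) rfl).symm
  · intro j hj
    obtain ⟨u, hu, huj⟩ := distLE_iff_exists_walk.1 hj
    exact distLE_iff_exists_walk.2 ⟨u, hu, hf j u hu huj⟩
  · intro j hj k hk hjk
    obtain ⟨u, hu, huj⟩ := distLE_iff_exists_walk.1 hj
    obtain ⟨u', hu', huk⟩ := distLE_iff_exists_walk.1 hk
    have h2 := hf k u' hu' huk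
    rw [← hjk] at h2
    obtain ⟨l, hl, hl'⟩ := (hmeet u u' (by omega)).2 ⟨f j, hf j u hu huj, h2⟩
    rw [huj] at hl
    rw [huk] at hl'
    simpa using hl.trans hl'.symm
  · intro k hk
    obtain ⟨u, hu, huk⟩ := distLE_iff_exists_walk.1 hk
    obtain ⟨j, hj, -⟩ := (hmeet u u (by omega)).2 ⟨k, huk, huk⟩
    refine ⟨j, distLE_iff_exists_walk.2 ⟨u, hu, hj⟩, ?_⟩
    simpa [huk] using (hf j u hu hj).symm
  · rw [matched_iff_edge, matched_iff_edge, hedge .mat j hj k hk, hlabel j hj]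

lemma SphIso.trans {r a b c : ℕ} {x y z : List A} (h1 : SphIso h r x a y b)
    (h2 : SphIso h r y b z c) : SphIso h r x a z c := by
  obtain ⟨f, hx, -, hfa, hf, hfl, hfe⟩ := h1
  obtain ⟨g, -, hz, hgb, hg, hgl, hge⟩ := h2
  refine ⟨g ∘ f, hx, hz, by simp [hfa, hgb], hg.comp hf, fun j hj => ?_, fun j hj k hk => ⟨?_, ?_⟩⟩
  · exact (hfl j hj).trans (hgl _ (hf.mapsTo hj))
  · exact (hfe j hj k hk).1.trans (hge _ (hf.mapsTo hj) _ (hf.mapsTo hk)).1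
  · exact fun s => ((hfe j hj k hk).2 s).trans ((hge _ (hf.mapsTo hj) _ (hf.mapsTo hk)).2 s)

end NestedWord

namespace NestedWord

variable {A C : Type} {M : ℕ}

/-- The entry of a table indexed by the short words of directions. -/
def view {X : Type} (L : DirWord M → Option X) (u : List Dir) : Option X :=
  if hu : u.length ≤ M then L ⟨u, hu⟩ else none

lemma view_of_le {X : Type} (f : List Dir → Option X) {u : List Dir} (hu : u.length ≤ M) :
    view (fun x : DirWord M => f x.1) u = f u := by
  rw [view, dif_pos hu]

/-- The local constraint on tables that are to list the letters and colours of the positions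
at the ends of the short walks, for a colouring separating nearby positions. -/
structure IsView (a : A) (L : DirWord M → Option (A × C))
    (n : Dir → Option (DirWord M → Option (A × C))) : Prop where
  letter : ∃ x, view L [] = some (a, x)
  cons : ∀ d (u : List Dir), u.length + 1 ≤ M → view L (d :: u) = (n d).bind fun L' => view L' u
  closed : ∀ u s : List Dir, u.length + s.length ≤ M →
    (view L u).map Prod.snd = (view L []).map Prod.snd → view L (u ++ s) = view L s
  proper : ∀ d, (view L [d]).map Prod.snd ≠ (view L []).map Prod.snd

/-- The table `L` describes the surroundings of position `i` up to radius `R`. -/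
def Describes (h : CRAlphabet 2 A) (R : ℕ) (L : DirWord M → Option (A × C)) (w : List A)
    (i : ℕ) : Prop :=
  ∀ u : List Dir, u.length ≤ R → (view L u).map Prod.fst = (walk h w u i).bind (w[·]?) ∧
    ((view L u).map Prod.snd = (view L []).map Prod.snd ↔ walk h w u i = some i)

variable {h : CRAlphabet 2 A} {v w : List A}

lemma Describes.sphIso {r i j : ℕ} {L : DirWord M → Option (A × C)} (hj : j < v.length)
    (hi : i < w.length) (h1 : Describes h (2 * r + 1) L v j) (h2 : Describes h (2 * r + 1) L w i) :
    SphIso h r v j w i :=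
  sphIso_of_walks hj hi (fun u hu => (h1 u hu).1.symm.trans (h2 u hu).1)
    (fun u hu => (h1 u hu).2.symm.trans (h2 u hu).2)

/-- Tables satisfying the local constraint describe the surroundings of their positions. -/
theorem describes_of_isView {R : ℕ} (hMR : 2 * R ≤ M) (hM : 0 < M)
    {σ : ℕ → DirWord M → Option (A × C)}
    (hσ : ∀ i a, w[i]? = some a → IsView a (σ i) (fun d => (step h w d i).map σ)) {i : ℕ}
    (hi : i < w.length) : Describes h R (σ i) w i := by
  have hview : ∀ i (hi : i < w.length), IsView w[i] (σ i) (fun d => (step h w d i).map σ) :=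
    fun i hi => hσ i _ (List.getElem?_eq_getElem hi)
  obtain ⟨x₀, -⟩ := (hview i hi).letter
  let lab : ℕ → A × C := fun j => (view (σ j) []).getD (w[i], x₀)
  have hnil : ∀ j < w.length, view (σ j) [] = some (lab j) := by
    intro j hj
    obtain ⟨x, hx⟩ := (hview j hj).letter
    simp [lab, hx]
  have hlet : ∀ j < w.length, w[j]? = some (lab j).1 := by
    intro j hj
    obtain ⟨x, hx⟩ := (hview j hj).letter
    simp [lab, hx, hj]
  have hwalk : ∀ (u : List Dir) j, j < w.length → u.length ≤ M →
      view (σ j) u = (walk h w u j).map lab := by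
    intro u
    induction u with
    | nil => exact fun j hj _ => hnil j hj
    | cons d u ih =>
      intro j hj hu
      rw [(hview j hj).cons d u hu, walk_cons]
      cases hs : step h w d j with
      | none => rfl
      | some k =>
        exact ih k (step_eq_some.1 hs).lt_right (by simp only [List.length_cons] at hu; omega)
  have hcol := eq_of_color_eq (h := h) lab hlet hMR
    (fun d i j he => by
      have h1 := (hview i he.lt_left).proper d
      rw [hwalk [d] i he.lt_left hM, walk_singleton, step_eq_some.2 he, hnil i he.lt_left] at h1
      simpa using Ne.symm h1)
    (fun i j u hi hu hc s hs => by
      have h1 := (hview i hi).closed u s hs (by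
        rw [hwalk u i hi (by omega), hu, hnil i hi]
        simpa using hc.symm)
      rw [hwalk _ i hi (by simpa using hs), hwalk s i hi (by omega), walk_append_of_eq _ hu] at h1
      exact h1)
  intro u hu
  rw [hwalk u i hi (by omega), hnil i hi]
  cases hs : walk h w u i with
  | none => simp
  | some j =>
    refine ⟨by simp [hlet j (walk_lt hi hs)], ?_⟩
    simp only [Option.map_some, Option.some_inj]
    exact ⟨fun he => (hcol _ hu u i j rfl hi hs he.symm).symm, fun he => by rw [he]⟩

/-- Every nested word has tables satisfying the local constraint. -/
theorem exists_isView (h : CRAlphabet 2 A) (hM : 0 < M) (w : List A) :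
    ∃ σ : ℕ → DirWord M → Option (A × Option (DirWord M)),
      ∀ i a, w[i]? = some a → IsView a (σ i) (fun d => (step h w d i).map σ) := by
  obtain ⟨κ, hκ⟩ := exists_coloring h w M
  let σ : ℕ → DirWord M → Option (A × Option (DirWord M)) :=
    fun i u => (walk h w u.1 i).bind fun j => (w[j]?).map fun a => (a, κ j)
  have hσ : ∀ i (u : List Dir), u.length ≤ M →
      view (σ i) u = (walk h w u i).bind fun j => (w[j]?).map fun a => (a, κ j) :=
    fun i _ hu =>
      view_of_le (fun u => (walk h w u i).bind fun j => (w[j]?).map fun a => (a, κ j)) hu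
  refine ⟨σ, fun i a ha => ?_⟩
  have hi : i < w.length := (List.getElem?_eq_some_iff.1 ha).1
  have hnil : view (σ i) [] = some (a, κ i) := by simp [hσ, ha]
  refine ⟨⟨κ i, hnil⟩, fun d u hu => ?_, fun u s hus he => ?_, fun d he => ?_⟩
  · rw [hσ i (d :: u) hu, walk_cons]
    cases hs : step h w d i with
    | none => rfl
    | some j => exact (hσ j u (by omega)).symm
  · rw [hnil, hσ _ _ (by omega)] at he
    rw [hσ _ _ (by simpa using hus), hσ _ _ (by omega)]
    cases hu : walk h w u i with
    | none => simp [hu] at he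
    | some j =>
      have hj := walk_lt hi hu
      have hc : κ j = κ i := by simpa [hu, hj] using he
      have hij : i = j := by
        by_contra hij
        exact hκ i j u hi (by omega) hu hij hc.symm
      rw [walk_append_of_eq _ hu, hij]
  · rw [hnil, hσ i [d] hM, walk_singleton] at he
    cases hs : step h w d i with
    | none => simp [hs] at he
    | some j =>
      have hj := step_eq_some.1 hs
      have hc : κ j = κ i := by simpa [hs, hj.lt_right] using he
      exact hκ i j [d] hi hM (by simpa using hs) hj.ne hc.symm

lemma ncard_lt_eq_count (p : ℕ → Prop) [DecidablePred p] (n : ℕ) :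
    {i | i < n ∧ p i}.ncard = Nat.count p n := by
  rw [Nat.count_eq_card_filter_range, ← Set.ncard_coe_finset]
  congr 1
  ext i
  simp

open Classical in
/-- The local constraint for counting, up to `t + 1`, the positions realizing a property of
their tables, such that the final value is `m`. -/
def IsCount {X : Type} (p : X → Prop) (t m : ℕ) (l : X × Fin (t + 2))
    (n : Dir → Option (X × Fin (t + 2))) : Prop :=
  l.2.val = min (t + 1) ((n .prev).elim 0 (fun l' => l'.2.val) + if p l.1 then 1 else 0) ∧
    (n .next = none → l.2.val = m)

open Classical in
lemma isCount_iff {X : Type} {p : X → Prop} {P : ℕ → Prop} {t m : ℕ} (hw : w ≠ []) {σ : ℕ → X}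
    (hp : ∀ i < w.length, p (σ i) ↔ P i) :
    (∃ k : ℕ → Fin (t + 2), ∀ i < w.length,
      IsCount p t m (σ i, k i) (fun d => (step h w d i).map fun j => (σ j, k j))) ↔
    min (t + 1) (Nat.count P w.length) = m := by
  have hpos : 0 < w.length := List.length_pos_iff.2 hw
  constructor
  · rintro ⟨k, hk⟩
    have hcount : ∀ i < w.length, (k i).val = min (t + 1) (Nat.count P (i + 1)) := by
      intro i
      induction i with
      | zero =>
        intro hi
        have := (hk 0 hi).1
        simp only [step_prev_zero, Option.map_none, Option.elim_none, hp 0 hi] at this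
        rw [this, Nat.count_succ, Nat.count_zero]
      | succ i ih =>
        intro hi
        have := (hk (i + 1) hi).1
        simp only [step_prev_succ hi, Option.map_some, Option.elim_some, hp _ hi,
          ih (by omega)] at this
        rw [this, Nat.count_succ P (i + 1)]
        omega
    have hlast := hcount (w.length - 1) (by omega)
    rw [Nat.sub_add_cancel hpos] at hlast
    rw [← hlast]
    refine (hk (w.length - 1) (by omega)).2 ?_
    have : step h w .next (w.length - 1) = none := step_next_eq_none.2 (by omega)
    simp only [this, Option.map_none]
  · rintro rfl
    refine ⟨fun i => ⟨min (t + 1) (Nat.count P (i + 1)), by omega⟩, fun i hi => ⟨?_, fun hn => ?_⟩⟩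
    · rcases i with _ | i
      · simp only [step_prev_zero, Option.map_none, Option.elim_none, hp 0 hi, Nat.count_succ,
          Nat.count_zero]
      · simp only [step_prev_succ hi, Option.map_some, Option.elim_some, hp _ hi]
        rw [Nat.count_succ _ (i + 1)]
        omega
    · simp only [Option.map_eq_none_iff, step_next_eq_none] at hn
      rw [le_antisymm hn hi]

/-- The nested words whose number of realizations of a given sphere, cut off at `t + 1`, is `m`
are recognized by a finite generalized nested-word automaton. -/
theorem exists_aut_count [Finite A] (h : CRAlphabet 2 A) (r t m : ℕ) (v : List A) (c : ℕ) :
    ∃ (Q : Type) (_ : Fintype Q) (B : GMNWA 2 A Q), gLang h B =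
      {w | w ≠ [] ∧ min (t + 1) {i | i < w.length ∧ SphIso h r v c w i}.ncard = m} := by
  classical
  let M := 2 * (2 * r + 1)
  have hM : 0 < M := by omega
  let X := DirWord M → Option (A × Option (DirWord M))
  let p : X → Prop := fun L =>
    ∃ w i, i < w.length ∧ Describes h (2 * r + 1) L w i ∧ SphIso h r v c w i
  let Φ : A → X × Fin (t + 2) → (Dir → Option (X × Fin (t + 2))) → Prop := fun a l n =>
    IsView a l.1 (fun d => (n d).map Prod.fst) ∧ IsCount p t m l n
  have hp : ∀ (w : List A) (σ : ℕ → X),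
      (∀ i a, w[i]? = some a → IsView a (σ i) (fun d => (step h w d i).map σ)) →
      ∀ i < w.length, p (σ i) ↔ SphIso h r v c w i := by
    intro w σ hσ i hi
    have hd := describes_of_isView (R := 2 * r + 1) le_rfl hM hσ hi
    exact ⟨fun ⟨w', j, hj, hd', hs⟩ => SphIso.trans hs (hd'.sphIso hj hi hd),
      fun hs => ⟨w, i, hi, hd, hs⟩⟩
  have : Finite X := inferInstanceAs (Finite (DirWord M → Option (A × Option (DirWord M))))
  refine ⟨LocalState A (X × Fin (t + 2)), Fintype.ofFinite _, localAut h Φ, ?_⟩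
  ext w
  rw [mem_gLang_localAut, Set.mem_ofPred_eq]
  refine and_congr_right fun hw => ?_
  rw [ncard_lt_eq_count]
  constructor
  · rintro ⟨σ, hσ⟩
    have hσ1 : ∀ i a, w[i]? = some a →
        IsView a (σ i).1 (fun d => (step h w d i).map fun j => (σ j).1) := by
      intro i a ha
      simpa only [Option.map_map, Function.comp_def] using (hσ i a ha).1
    refine (isCount_iff (h := h) hw (hp w (fun i => (σ i).1) hσ1)).1
      ⟨fun i => (σ i).2, fun i hi => ?_⟩
    exact (hσ i _ (List.getElem?_eq_getElem hi)).2
  · intro hm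
    obtain ⟨σ, hσ⟩ := exists_isView h hM w
    obtain ⟨k, hk⟩ := (isCount_iff (h := h) hw (hp w σ hσ)).2 hm
    refine ⟨fun i => (σ i, k i), fun i a ha => ⟨?_, hk i (List.getElem?_eq_some_iff.1 ha).1⟩⟩
    simpa only [Option.map_map, Function.comp_def] using hσ i a ha

end NestedWord

/-- for every radius `r`, every `r`-sphere isomorphism type
(represented by a pointed nested word `(v,c)`) and every threshold `t`, the
sets of nested words realizing the sphere exactly `t` times, respectively
more than `t` times, are recognized by (finite) generalized 2-stack
nested-word automata. -/
theorem stmt19 (A : Type) [Fintype A] (h : CRAlphabet 2 A) (r t : ℕ)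
    (v : List A) (c : ℕ) (hc : c < v.length) :
    (∃ (Q : Type) (_ : Fintype Q) (B : GMNWA 2 A Q),
      gLang h B =
        {w | w ≠ [] ∧ {i | i < w.length ∧ SphIso h r v c w i}.ncard = t}) ∧
    (∃ (Q : Type) (_ : Fintype Q) (B : GMNWA 2 A Q),
      gLang h B =
        {w | w ≠ [] ∧ t < {i | i < w.length ∧ SphIso h r v c w i}.ncard}) := by
  refine ⟨?_, ?_⟩
  · obtain ⟨Q, hQ, B, hB⟩ := NestedWord.exists_aut_count h r t t v c
    exact ⟨Q, hQ, B, hB.trans (Set.ext fun w => and_congr_right fun _ => by omega)⟩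
  · obtain ⟨Q, hQ, B, hB⟩ := NestedWord.exists_aut_count h r t (t + 1) v c
    exact ⟨Q, hQ, B, hB.trans (Set.ext fun w => and_congr_right fun _ => by omega)⟩
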